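/- (Generalized self-concordance bound for the congestion, via the explicit third derivative.) Let T ⊆ {1,…,m} be a connected spanning set of edges, let L_T = Σ_{e ∈ T} w_e a_e a_eᵀ, and let ρ_T ∈ ℝ^m have entries ρ_T(e) = a_eᵀ L_T^† a_e. Let s ∈ [0,1]^m satisfy s_e = 1 for all e ∈ T, let x = L_s^† d, and for h ∈ ℝ^m put V(h) = Aᵀ diag(w ∘ h) A. Then for all directions u, v ∈ ℝ^m, | 6 · xᵀ V(u) L_s^† V(v) L_s^† V(u) x | ≤ 3 · ‖w ∘ ρ_T‖₂ · ‖v‖₂ · ( 2 · xᵀ V(u) L_s^† V(u) x ). (The left-hand side is the third directional derivative |D³φ(s)[v,u,u]| and the factor 2 xᵀ V(u) L_s^† V(u) x is the local Hessian quadratic form ‖u‖²_{∇²φ(s)}, so this says φ is (M,ν)-generalized self-concordant with ν = 2 and M = 3‖w ∘ ρ_T‖₂.) -/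

import Mathlib

open Matrix MeasureTheory BigOperators

noncomputable section

/-- `A` is a signed incidence matrix: each row is `e_i - e_j` for some `i ≠ j`. -/
def isIncidence (n m : ℕ) (A : Matrix (Fin m) (Fin n) ℝ) : Prop :=
  ∀ e : Fin m, ∃ i j : Fin n, i ≠ j ∧
    A e = fun k => (if k = i then (1 : ℝ) else 0) - (if k = j then (1 : ℝ) else 0)

/-- The matrix `1 1ᵀ / n`, with all entries equal to `1/n`. -/
def onesMat (n : ℕ) : Matrix (Fin n) (Fin n) ℝ := fun _ _ => (1 : ℝ) / n

/-- The switched Laplacian `L_s = Aᵀ diag(w ∘ s) A`. -/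
def Lap (n m : ℕ) (A : Matrix (Fin m) (Fin n) ℝ) (w s : Fin m → ℝ) :
    Matrix (Fin n) (Fin n) ℝ :=
  Aᵀ * Matrix.diagonal (fun e => w e * s e) * A

/-- The Moore–Penrose pseudoinverse of a connected Laplacian:
`L† = (L + 1 1ᵀ/n)⁻¹ - 1 1ᵀ/n`. -/
def Lpinv (n m : ℕ) (A : Matrix (Fin m) (Fin n) ℝ) (w s : Fin m → ℝ) :
    Matrix (Fin n) (Fin n) ℝ :=
  (Lap n m A w s + onesMat n)⁻¹ - onesMat n

/-- Connectivity, encoded as: the kernel of the Laplacian is exactly `span(1)`. -/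
def kerIsOnes (n : ℕ) (L : Matrix (Fin n) (Fin n) ℝ) : Prop :=
  ∀ y : Fin n → ℝ, L.mulVec y = 0 ↔ ∃ c : ℝ, y = fun _ => c

/-- The relaxed congestion `φ(s) = dᵀ L_s† d`. -/
def phi (n m : ℕ) (A : Matrix (Fin m) (Fin n) ℝ) (w s : Fin m → ℝ) (d : Fin n → ℝ) : ℝ :=
  d ⬝ᵥ (Lpinv n m A w s).mulVec d

section Laplacian

variable {n m : ℕ} {A : Matrix (Fin m) (Fin n) ℝ} {w σ : Fin m → ℝ}

lemma sum_row_eq_zero_of_isIncidence (hA : isIncidence n m A) (e : Fin m) : ∑ k, A e k = 0 := by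
  obtain ⟨i, j, -, h⟩ := hA e
  simp [h]

lemma mulVec_const_of_isIncidence (hA : isIncidence n m A) (c : ℝ) :
    A *ᵥ (fun _ => c) = 0 := by
  ext e
  simp [mulVec, dotProduct, ← Finset.sum_mul, sum_row_eq_zero_of_isIncidence hA]

lemma Lap_mulVec (z : Fin n → ℝ) :
    Lap n m A w σ *ᵥ z = Aᵀ *ᵥ (fun e => w e * σ e * (A *ᵥ z) e) := by
  rw [Lap, ← mulVec_mulVec, ← mulVec_mulVec]
  congr 1
  ext e
  rw [mulVec_diagonal]

lemma dotProduct_Lap_mulVec (y z : Fin n → ℝ) :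
    y ⬝ᵥ Lap n m A w σ *ᵥ z = ∑ e, w e * σ e * ((A *ᵥ y) e * (A *ᵥ z) e) := by
  rw [Lap_mulVec, dotProduct_mulVec, vecMul_transpose, dotProduct]
  exact Finset.sum_congr rfl fun e _ => by ring

lemma Lap_transpose : (Lap n m A w σ)ᵀ = Lap n m A w σ := by
  simp [Lap, Matrix.mul_assoc]

lemma onesMat_mulVec (z : Fin n → ℝ) : onesMat n *ᵥ z = fun _ => (∑ i, z i) / n := by
  ext i
  simp [onesMat, mulVec, dotProduct, ← Finset.mul_sum, div_eq_inv_mul]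

lemma onesMat_transpose : (onesMat n)ᵀ = onesMat n := rfl

lemma Lpinv_transpose : (Lpinv n m A w σ)ᵀ = Lpinv n m A w σ := by
  rw [Lpinv, transpose_sub, transpose_nonsing_inv, transpose_add, Lap_transpose, onesMat_transpose]

lemma sum_Lap_mulVec (hA : isIncidence n m A) (z : Fin n → ℝ) :
    ∑ i, (Lap n m A w σ *ᵥ z) i = 0 := by
  have h := dotProduct_Lap_mulVec (A := A) (w := w) (σ := σ) (fun _ => 1) z
  simpa [mulVec_const_of_isIncidence hA, dotProduct] using h

lemma sum_Lap_add_onesMat_mulVec (hn : n ≠ 0) (hA : isIncidence n m A) (z : Fin n → ℝ) :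
    ∑ i, ((Lap n m A w σ + onesMat n) *ᵥ z) i = ∑ i, z i := by
  have hn' : (n : ℝ) ≠ 0 := Nat.cast_ne_zero.mpr hn
  simp only [add_mulVec, Pi.add_apply, Finset.sum_add_distrib, sum_Lap_mulVec hA,
    onesMat_mulVec, Finset.sum_const, Finset.card_univ, Fintype.card_fin, nsmul_eq_mul]
  field_simp
  ring

lemma isUnit_Lap_add_onesMat (hn : n ≠ 0) (hA : isIncidence n m A)
    (hker : kerIsOnes n (Lap n m A w σ)) : IsUnit (Lap n m A w σ + onesMat n) := by
  rw [← mulVec_injective_iff_isUnit]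
  refine (injective_iff_map_eq_zero (Lap n m A w σ + onesMat n).mulVecLin).mpr fun z hz => ?_
  rw [mulVecLin_apply] at hz
  have hsum : ∑ i, z i = 0 := by
    rw [← sum_Lap_add_onesMat_mulVec (w := w) (σ := σ) hn hA z, hz]
    simp
  have hL : Lap n m A w σ *ᵥ z = 0 := by
    rw [add_mulVec, onesMat_mulVec, hsum] at hz
    ext i
    simpa using congrFun hz i
  obtain ⟨c, rfl⟩ := (hker z).mp hL
  have hc : c = 0 := by simpa [hn] using hsum
  ext
  exact hc

/-- On the orthogonal complement of the constants, `Lpinv` is a right inverse of the Laplacian. -/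
lemma Lap_mulVec_Lpinv_mulVec (hn : n ≠ 0) (hA : isIncidence n m A)
    (hker : kerIsOnes n (Lap n m A w σ)) {y : Fin n → ℝ} (hy : ∑ i, y i = 0) :
    Lap n m A w σ *ᵥ (Lpinv n m A w σ *ᵥ y) = y := by
  have hdet := (isUnit_iff_isUnit_det _).mp (isUnit_Lap_add_onesMat hn hA hker)
  have hM : (Lap n m A w σ + onesMat n) *ᵥ ((Lap n m A w σ + onesMat n)⁻¹ *ᵥ y) = y := by
    rw [mulVec_mulVec, mul_nonsing_inv _ hdet, one_mulVec]
  have hP : Lpinv n m A w σ *ᵥ y = (Lap n m A w σ + onesMat n)⁻¹ *ᵥ y := by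
    ext i
    simp [Lpinv, sub_mulVec, onesMat_mulVec, hy]
  rw [hP]
  have hsum := sum_Lap_add_onesMat_mulVec (w := w) (σ := σ) hn hA
    ((Lap n m A w σ + onesMat n)⁻¹ *ᵥ y)
  rw [hM, hy] at hsum
  rw [add_mulVec, onesMat_mulVec _, ← hsum] at hM
  ext i
  simpa using congrFun hM i

lemma sq_dotProduct_Lap_mulVec_le (hwσ : ∀ e, 0 ≤ w e * σ e) (y z : Fin n → ℝ) :
    (y ⬝ᵥ Lap n m A w σ *ᵥ z) ^ 2 ≤
      (y ⬝ᵥ Lap n m A w σ *ᵥ y) * (z ⬝ᵥ Lap n m A w σ *ᵥ z) := by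
  simp only [dotProduct_Lap_mulVec]
  exact Finset.sum_sq_le_sum_mul_sum_of_sq_le_mul _
    (fun e _ => mul_nonneg (hwσ e) (mul_self_nonneg _))
    (fun e _ => mul_nonneg (hwσ e) (mul_self_nonneg _)) fun e _ => le_of_eq (by ring)

lemma dotProduct_Lap_mulVec_self_nonneg (hwσ : ∀ e, 0 ≤ w e * σ e) (z : Fin n → ℝ) :
    0 ≤ z ⬝ᵥ Lap n m A w σ *ᵥ z := by
  rw [dotProduct_Lap_mulVec]
  exact Finset.sum_nonneg fun e _ => mul_nonneg (hwσ e) (mul_self_nonneg _)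

lemma dotProduct_Lap_mulVec_self_mono (hw : ∀ e, 0 ≤ w e) {τ : Fin m → ℝ} (h : ∀ e, τ e ≤ σ e)
    (z : Fin n → ℝ) : z ⬝ᵥ Lap n m A w τ *ᵥ z ≤ z ⬝ᵥ Lap n m A w σ *ᵥ z := by
  simp only [dotProduct_Lap_mulVec]
  exact Finset.sum_le_sum fun e _ => mul_le_mul_of_nonneg_right
    (mul_le_mul_of_nonneg_left (h e) (hw e)) (mul_self_nonneg _)

lemma Lap_mulVec_eq_zero_of_dotProduct_eq_zero (hwσ : ∀ e, 0 ≤ w e * σ e) {z : Fin n → ℝ}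
    (hz : z ⬝ᵥ Lap n m A w σ *ᵥ z = 0) : Lap n m A w σ *ᵥ z = 0 := by
  refine dotProduct_self_eq_zero.mp
    ((pow_eq_zero_iff two_ne_zero).mp (le_antisymm ?_ (sq_nonneg _)))
  have h := sq_dotProduct_Lap_mulVec_le (A := A) hwσ (Lap n m A w σ *ᵥ z) z
  rwa [hz, mul_zero] at h

/-- Increasing the weights of a connected graph keeps it connected. -/
lemma kerIsOnes_Lap_mono (hA : isIncidence n m A) (hw : ∀ e, 0 ≤ w e) {τ : Fin m → ℝ}
    (hτ : ∀ e, 0 ≤ τ e) (h : ∀ e, τ e ≤ σ e) (hker : kerIsOnes n (Lap n m A w τ)) :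
    kerIsOnes n (Lap n m A w σ) := by
  have hwτ : ∀ e, 0 ≤ w e * τ e := fun e => mul_nonneg (hw e) (hτ e)
  refine fun z => ⟨fun hz => (hker z).mp (Lap_mulVec_eq_zero_of_dotProduct_eq_zero hwτ ?_), ?_⟩
  · refine le_antisymm ?_ (dotProduct_Lap_mulVec_self_nonneg hwτ z)
    simpa [hz] using dotProduct_Lap_mulVec_self_mono (A := A) hw h z
  · rintro ⟨c, rfl⟩
    rw [Lap_mulVec, mulVec_const_of_isIncidence hA]
    ext
    simp [mulVec, dotProduct]

lemma effectiveResistance_eq (hn : n ≠ 0) (hA : isIncidence n m A)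
    (hker : kerIsOnes n (Lap n m A w σ)) (e : Fin m) :
    A e ⬝ᵥ Lpinv n m A w σ *ᵥ A e =
      (Lpinv n m A w σ *ᵥ A e) ⬝ᵥ Lap n m A w σ *ᵥ (Lpinv n m A w σ *ᵥ A e) := by
  rw [Lap_mulVec_Lpinv_mulVec hn hA hker (sum_row_eq_zero_of_isIncidence hA e), dotProduct_comm]

/-- A squared potential difference is at most the effective resistance times the energy. -/
lemma sq_mulVec_le_effectiveResistance_mul (hn : n ≠ 0) (hA : isIncidence n m A)
    (hwσ : ∀ e, 0 ≤ w e * σ e) (hker : kerIsOnes n (Lap n m A w σ)) (e : Fin m)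
    (z : Fin n → ℝ) :
    ((A *ᵥ z) e) ^ 2 ≤ (A e ⬝ᵥ Lpinv n m A w σ *ᵥ A e) * (z ⬝ᵥ Lap n m A w σ *ᵥ z) := by
  rw [effectiveResistance_eq hn hA hker]
  convert sq_dotProduct_Lap_mulVec_le hwσ (Lpinv n m A w σ *ᵥ A e) z using 2
  rw [dotProduct_mulVec, ← mulVec_transpose, Lap_transpose,
    Lap_mulVec_Lpinv_mulVec hn hA hker (sum_row_eq_zero_of_isIncidence hA e)]
  rfl

lemma effectiveResistance_nonneg (hn : n ≠ 0) (hA : isIncidence n m A)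
    (hwσ : ∀ e, 0 ≤ w e * σ e) (hker : kerIsOnes n (Lap n m A w σ)) (e : Fin m) :
    0 ≤ A e ⬝ᵥ Lpinv n m A w σ *ᵥ A e := by
  rw [effectiveResistance_eq hn hA hker]
  exact dotProduct_Lap_mulVec_self_nonneg hwσ _

lemma abs_dotProduct_Lap_mulVec_self_le (hw : ∀ e, 0 ≤ w e) {r : Fin m → ℝ} {E : ℝ} (hE : 0 ≤ E)
    {z : Fin n → ℝ} (hz : ∀ e, ((A *ᵥ z) e) ^ 2 ≤ r e * E) (v : Fin m → ℝ) :
    |z ⬝ᵥ Lap n m A w v *ᵥ z| ≤ √(∑ e, (w e * r e) ^ 2) * √(∑ e, v e ^ 2) * E := by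
  rw [dotProduct_Lap_mulVec]
  calc |∑ e, w e * v e * ((A *ᵥ z) e * (A *ᵥ z) e)|
      ≤ ∑ e, |w e * v e * ((A *ᵥ z) e * (A *ᵥ z) e)| := Finset.abs_sum_le_sum_abs _ _
    _ ≤ ∑ e, (w e * r e) * |v e| * E := by
        refine Finset.sum_le_sum fun e _ => ?_
        rw [abs_mul, abs_mul, abs_of_nonneg (hw e), abs_mul_self, ← pow_two]
        calc w e * |v e| * ((A *ᵥ z) e) ^ 2 ≤ w e * |v e| * (r e * E) :=
              mul_le_mul_of_nonneg_left (hz e) (mul_nonneg (hw e) (abs_nonneg _))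
          _ = (w e * r e) * |v e| * E := by ring
    _ = (∑ e, (w e * r e) * |v e|) * E := by rw [Finset.sum_mul]
    _ ≤ √(∑ e, (w e * r e) ^ 2) * √(∑ e, v e ^ 2) * E := by
        refine mul_le_mul_of_nonneg_right ?_ hE
        simpa [sq_abs] using Real.sum_mul_le_sqrt_mul_sqrt Finset.univ
          (fun e => w e * r e) (fun e => |v e|)

end Laplacian

/-- Generalized self-concordance bound for the congestion.
With `T` a connected spanning edge set, `ρ_T(e) = a_eᵀ L_T† a_e`,
`s ∈ [0,1]^m` equal to `1` on `T`, `x = L_s† d`, and `V(h) = Aᵀ diag(w∘h) A`,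
for all directions `u, v`:
`|6 xᵀ V(u) L_s† V(v) L_s† V(u) x| ≤ 3 ‖w∘ρ_T‖₂ ‖v‖₂ (2 xᵀ V(u) L_s† V(u) x)`,
i.e. `φ` is `(M,ν)`-generalized self-concordant with `ν = 2`, `M = 3‖w∘ρ_T‖₂`. -/
theorem congestion_generalized_self_concordance
    (n m : ℕ) (hn : 2 ≤ n) (hm : 1 ≤ m)
    (A : Matrix (Fin m) (Fin n) ℝ) (hA : isIncidence n m A)
    (w : Fin m → ℝ) (hw : ∀ e, 0 < w e)
    (d : Fin n → ℝ) (hd : ∑ i, d i = 0)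
    (T : Finset (Fin m))
    (hTconn : kerIsOnes n (Lap n m A w (fun e => if e ∈ T then 1 else 0)))
    (s : Fin m → ℝ) (hs : ∀ e, 0 ≤ s e ∧ s e ≤ 1) (hsT : ∀ e ∈ T, s e = 1)
    (u v : Fin m → ℝ) :
    |6 * ((Lpinv n m A w s).mulVec d ⬝ᵥ
        (Lap n m A w u * Lpinv n m A w s * Lap n m A w v * Lpinv n m A w s *
          Lap n m A w u).mulVec ((Lpinv n m A w s).mulVec d))| ≤
      3 * Real.sqrt (∑ e, (w e *
            (A e ⬝ᵥ (Lpinv n m A w (fun e => if e ∈ T then 1 else 0)).mulVec (A e))) ^ 2) *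
        Real.sqrt (∑ e, (v e) ^ 2) *
        (2 * ((Lpinv n m A w s).mulVec d ⬝ᵥ
          (Lap n m A w u * Lpinv n m A w s * Lap n m A w u).mulVec
            ((Lpinv n m A w s).mulVec d))) := by
  have hn0 : n ≠ 0 := by omega
  have hw' : ∀ e, 0 ≤ w e := fun e => (hw e).le
  set τ : Fin m → ℝ := fun e => if e ∈ T then 1 else 0 with hτ
  have hτ0 : ∀ e, 0 ≤ τ e := fun e => by
    simp only [hτ]
    split_ifs <;> norm_num
  have hτs : ∀ e, τ e ≤ s e := fun e => by
    simp only [hτ]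
    split_ifs with h
    · exact (hsT e h).ge
    · exact (hs e).1
  have hwτ : ∀ e, 0 ≤ w e * τ e := fun e => mul_nonneg (hw' e) (hτ0 e)
  have hker := kerIsOnes_Lap_mono hA hw' hτ0 hτs hTconn
  set x := Lpinv n m A w s *ᵥ d
  set P := Lpinv n m A w s
  set z := P *ᵥ (Lap n m A w u *ᵥ x) with hz
  have hPT : Pᵀ = P := Lpinv_transpose
  have hLz : Lap n m A w s *ᵥ z = Lap n m A w u *ᵥ x :=
    Lap_mulVec_Lpinv_mulVec hn0 hA hker (sum_Lap_mulVec hA x)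
  have hleft : x ᵥ* Lap n m A w u ᵥ* P = z := by
    rw [← mulVec_transpose, ← mulVec_transpose, hPT, Lap_transpose]
  have hthird : x ⬝ᵥ (Lap n m A w u * P * Lap n m A w v * P * Lap n m A w u) *ᵥ x =
      z ⬝ᵥ Lap n m A w v *ᵥ z := by
    simp only [← mulVec_mulVec]
    rw [← hz, dotProduct_mulVec, dotProduct_mulVec, hleft]
  have hhess : x ⬝ᵥ (Lap n m A w u * P * Lap n m A w u) *ᵥ x = z ⬝ᵥ Lap n m A w s *ᵥ z := by
    simp only [← mulVec_mulVec]
    rw [hLz, dotProduct_mulVec, dotProduct_mulVec, hleft]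
  have hr := effectiveResistance_nonneg hn0 hA hwτ hTconn
  have hE : 0 ≤ z ⬝ᵥ Lap n m A w s *ᵥ z :=
    dotProduct_Lap_mulVec_self_nonneg (fun e => mul_nonneg (hw' e) (hs e).1) z
  have hbound := abs_dotProduct_Lap_mulVec_self_le hw' hE (fun e =>
    (sq_mulVec_le_effectiveResistance_mul hn0 hA hwτ hTconn e z).trans
      (mul_le_mul_of_nonneg_left (dotProduct_Lap_mulVec_self_mono hw' hτs z) (hr e))) v
  rw [hthird, hhess, abs_mul, abs_of_pos (by norm_num : (0 : ℝ) < 6)]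
  linarith
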